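/- arXiv:2512.21726 — 2 statements merged into one kernel-verified Lean document; each statement's English description precedes it below -/
import Mathlib

section
/- Let C be a category with binary products and let F₁, F₂ : Cᵒᵖ ⥤ Type be presheaves on C. Let P be the functor (CostructuredArrow yoneda F₁) × (CostructuredArrow yoneda F₂) ⥤ CostructuredArrow yoneda (F₁ ⨯ F₂) which sends a pair of objects ((X₁, s₁ : yoneda X₁ ⟶ F₁), (X₂, s₂ : yoneda X₂ ⟶ F₂)) to the object (X₁ ⨯ X₂, ⟨s₁ ∘ yoneda(pr₁), s₂ ∘ yoneda(pr₂)⟩ : yoneda (X₁ ⨯ X₂) ⟶ F₁ ⨯ F₂), where pr₁, pr₂ are the product projections and ⟨-,-⟩ is the pairing into the pointwise product presheaf. Then P is a final (cofinal) functor: for every object d of CostructuredArrow yoneda (F₁ ⨯ F₂), the comma category of objects of the source under d (the structured-arrow category StructuredArrow d P) is connected; equivalently, restriction of any diagram along P does not change colimits. -/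
open CategoryTheory CategoryTheory.Limits

universe v u

variable {C : Type u} [Category.{v} C] [HasBinaryProducts C]

/-- The functor `(CostructuredArrow yoneda F₁) × (CostructuredArrow yoneda F₂) ⥤
CostructuredArrow yoneda (F₁ ⨯ F₂)` sending a pair `((X₁, s₁), (X₂, s₂))` to
`(X₁ ⨯ X₂, ⟨s₁ ∘ yoneda(pr₁), s₂ ∘ yoneda(pr₂)⟩)`. -/
noncomputable def prodMkFunctor (F₁ F₂ : Cᵒᵖ ⥤ Type v) :
    CostructuredArrow yoneda F₁ × CostructuredArrow yoneda F₂ ⥤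
      CostructuredArrow yoneda (F₁ ⨯ F₂) where
  obj p := CostructuredArrow.mk
    (prod.lift (yoneda.map (prod.fst : p.1.left ⨯ p.2.left ⟶ p.1.left) ≫ p.1.hom)
      (yoneda.map (prod.snd : p.1.left ⨯ p.2.left ⟶ p.2.left) ≫ p.2.hom))
  map {p q} f := CostructuredArrow.homMk (prod.map f.1.left f.2.left) (by
    apply Limits.prod.hom_ext
    · simp only [CostructuredArrow.mk_hom_eq_self, Category.assoc, prod.lift_fst,
        ← Functor.map_comp_assoc, prod.map_fst]
      simp [CostructuredArrow.w]
    · simp only [CostructuredArrow.mk_hom_eq_self, Category.assoc, prod.lift_snd,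
        ← Functor.map_comp_assoc, prod.map_snd]
      simp [CostructuredArrow.w])
  map_id p := by
    apply CostructuredArrow.hom_ext
    simp
  map_comp f g := by
    apply CostructuredArrow.hom_ext
    simp

/-- The functor `CostructuredArrow yoneda (F₁ ⨯ F₂) ⥤ CostructuredArrow yoneda F₁ ×
CostructuredArrow yoneda F₂` sending `(X, s)` to `((X, pr₁ ∘ s), (X, pr₂ ∘ s))`. -/
noncomputable abbrev costructuredArrowYonedaProdFstSnd (F₁ F₂ : Cᵒᵖ ⥤ Type v) :
    CostructuredArrow yoneda (F₁ ⨯ F₂) ⥤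
      CostructuredArrow yoneda F₁ × CostructuredArrow yoneda F₂ :=
  (CostructuredArrow.map prod.fst).prod' (CostructuredArrow.map prod.snd)

/-- `prodMkFunctor F₁ F₂` is right adjoint to the functor induced by the two projections. -/
noncomputable def prodMkFunctorAdjunction (F₁ F₂ : Cᵒᵖ ⥤ Type v) :
    costructuredArrowYonedaProdFstSnd F₁ F₂ ⊣ prodMkFunctor F₁ F₂ :=
  Adjunction.mkOfUnitCounit
    { unit :=
        { app d := CostructuredArrow.homMk (prod.lift (𝟙 d.left) (𝟙 d.left)) (by
            apply Limits.prod.hom_ext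
            · have h : yoneda.map (prod.lift (𝟙 d.left) (𝟙 d.left)) ≫ yoneda.map prod.fst ≫
                  d.hom ≫ prod.fst = d.hom ≫ prod.fst := by
                rw [← Functor.map_comp_assoc, prod.lift_fst, CategoryTheory.Functor.map_id,
                  Category.id_comp]
              exact (Category.assoc _ _ _).trans ((whisker_eq _ (prod.lift_fst _ _)).trans h)
            · have h : yoneda.map (prod.lift (𝟙 d.left) (𝟙 d.left)) ≫ yoneda.map prod.snd ≫
                  d.hom ≫ prod.snd = d.hom ≫ prod.snd := by
                rw [← Functor.map_comp_assoc, prod.lift_snd, CategoryTheory.Functor.map_id,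
                  Category.id_comp]
              exact (Category.assoc _ _ _).trans ((whisker_eq _ (prod.lift_snd _ _)).trans h))
          naturality d e f := by
            apply CostructuredArrow.hom_ext
            apply Limits.prod.hom_ext <;> simp [prodMkFunctor] }
      counit :=
        { app p :=
            (CostructuredArrow.homMk (prod.fst : p.1.left ⨯ p.2.left ⟶ p.1.left)
              (prod.lift_fst _ _).symm,
             CostructuredArrow.homMk (prod.snd : p.1.left ⨯ p.2.left ⟶ p.2.left)
              (prod.lift_snd _ _).symm)
          naturality p q f := by
            apply Prod.ext <;> apply CostructuredArrow.hom_ext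
            · exact prod.map_fst _ _
            · exact prod.map_snd _ _ }
      left_triangle := by
        ext d
        · simp
          exact prod.lift_fst _ _
        · simp
          exact prod.lift_snd _ _
      right_triangle := by
        ext p
        apply Limits.prod.hom_ext
        · simp [prodMkFunctor]
          exact prod.lift_fst _ _
        · simp [prodMkFunctor]
          exact prod.lift_snd _ _ }

/-- The functor `prodMkFunctor F₁ F₂` is final: for every object `d` of
`CostructuredArrow yoneda (F₁ ⨯ F₂)`, the category `StructuredArrow d (prodMkFunctor F₁ F₂)`
is connected. -/
theorem prodMkFunctor_final (F₁ F₂ : Cᵒᵖ ⥤ Type v) :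
    (prodMkFunctor F₁ F₂).Final := by
  exact Functor.final_of_adjunction (prodMkFunctorAdjunction F₁ F₂)
end

section
/- Let C be a category with binary products, let F : Cᵒᵖ ⥤ Type be a presheaf, and let X be an object of C. Consider the functor R : CostructuredArrow yoneda F ⥤ CostructuredArrow yoneda (F ⨯ yoneda X) sending (Z, s : yoneda Z ⟶ F) to (Z ⨯ X, ⟨s ∘ yoneda(pr₁), yoneda(pr₂)⟩), where pr₁ : Z ⨯ X → Z and pr₂ : Z ⨯ X → X are the product projections. Then R admits a left adjoint, namely the functor given by postcomposition with the projection F ⨯ yoneda X ⟶ F (sending (Z', (s', f)) to (Z', s')). In particular, R is a final (cofinal) functor. -/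
open CategoryTheory CategoryTheory.Limits

universe v u

variable {C : Type u} [Category.{v} C] [HasBinaryProducts C]

/-- The functor `CostructuredArrow yoneda F ⥤ CostructuredArrow yoneda (F ⨯ yoneda X)`
sending `(Z, s)` to `(Z ⨯ X, ⟨s ∘ yoneda(pr₁), yoneda(pr₂)⟩)`. -/
noncomputable def timesRepresentableFunctor (F : Cᵒᵖ ⥤ Type v) (X : C) :
    CostructuredArrow yoneda F ⥤ CostructuredArrow yoneda (F ⨯ yoneda.obj X) where
  obj Z := CostructuredArrow.mk
    (prod.lift (yoneda.map (prod.fst : Z.left ⨯ X ⟶ Z.left) ≫ Z.hom)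
      (yoneda.map (prod.snd : Z.left ⨯ X ⟶ X)))
  map {Z W} f := CostructuredArrow.homMk (prod.map f.left (𝟙 X)) (by
    apply Limits.prod.hom_ext
    · simp only [CostructuredArrow.mk_hom_eq_self, Category.assoc, prod.lift_fst,
        ← Functor.map_comp_assoc, prod.map_fst]
      simp [CostructuredArrow.w]
    · simp only [CostructuredArrow.mk_hom_eq_self, Category.assoc, prod.lift_snd,
        ← Functor.map_comp, prod.map_snd, Category.comp_id])
  map_id Z := by
    apply CostructuredArrow.hom_ext
    simp
  map_comp f g := by
    apply CostructuredArrow.hom_ext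
    simp

namespace timesRepresentableFunctor

variable (F : Cᵒᵖ ⥤ Type v) (X : C)

/-- The morphism to `X` underlying the second component of `W.hom`. -/
noncomputable def toFactor (W : CostructuredArrow yoneda (F ⨯ yoneda.obj X)) : W.left ⟶ X :=
  yoneda.preimage (W.hom ≫ (prod.snd : F ⨯ yoneda.obj X ⟶ yoneda.obj X))

lemma yoneda_map_toFactor (W : CostructuredArrow yoneda (F ⨯ yoneda.obj X)) :
    yoneda.map (toFactor F X W) =
      W.hom ≫ (prod.snd : F ⨯ yoneda.obj X ⟶ yoneda.obj X) :=
  yoneda.map_preimage _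

lemma toFactor_naturality {W W' : CostructuredArrow yoneda (F ⨯ yoneda.obj X)} (f : W ⟶ W') :
    f.left ≫ toFactor F X W' = toFactor F X W := by
  apply yoneda.map_injective
  rw [Functor.map_comp, yoneda_map_toFactor, yoneda_map_toFactor, ← Category.assoc,
    CostructuredArrow.w]

lemma toFactor_obj (Z : CostructuredArrow yoneda F) :
    toFactor F X ((timesRepresentableFunctor F X).obj Z) = (prod.snd : Z.left ⨯ X ⟶ X) := by
  apply yoneda.map_injective
  rw [yoneda_map_toFactor]
  exact prod.lift_snd _ _

/-- Postcomposition with `F ⨯ yoneda X ⟶ F` is left adjoint to `timesRepresentableFunctor F X`. -/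
noncomputable def adjunction :
    CostructuredArrow.map (S := yoneda) (prod.fst : F ⨯ yoneda.obj X ⟶ F) ⊣
      timesRepresentableFunctor F X where
  unit :=
    { app W := CostructuredArrow.homMk (prod.lift (𝟙 W.left) (toFactor F X W)) (by
        apply Limits.prod.hom_ext
        · dsimp [timesRepresentableFunctor]
          rw [Category.assoc, prod.lift_fst, ← Functor.map_comp_assoc, prod.lift_fst,
            CategoryTheory.Functor.map_id, Category.id_comp]
        · dsimp [timesRepresentableFunctor]
          rw [Category.assoc, prod.lift_snd, ← Functor.map_comp, prod.lift_snd,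
            yoneda_map_toFactor])
      naturality W W' f := by
        apply CostructuredArrow.hom_ext
        apply Limits.prod.hom_ext <;>
          simp [timesRepresentableFunctor, toFactor_naturality] }
  counit :=
    { app Z := CostructuredArrow.homMk (prod.fst : Z.left ⨯ X ⟶ Z.left)
        (prod.lift_fst _ _).symm
      naturality Z Z' f := by
        apply CostructuredArrow.hom_ext
        exact prod.map_fst _ _ }
  left_triangle_components W := by
    apply CostructuredArrow.hom_ext
    exact prod.lift_fst _ _
  right_triangle_components Z := by
    apply CostructuredArrow.hom_ext
    change (prod.lift (𝟙 (Z.left ⨯ X))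
        (toFactor F X ((timesRepresentableFunctor F X).obj Z)) :
          Z.left ⨯ X ⟶ (Z.left ⨯ X) ⨯ X) ≫ prod.map prod.fst (𝟙 X) = 𝟙 (Z.left ⨯ X)
    rw [toFactor_obj]
    simp

end timesRepresentableFunctor

/-- The functor `timesRepresentableFunctor F X` admits a left adjoint, namely the functor
given by postcomposition with the projection `F ⨯ yoneda X ⟶ F` (sending `(Z', (s', f))`
to `(Z', s')`). In particular, `timesRepresentableFunctor F X` is final. -/
theorem timesRepresentableFunctor_leftAdjoint_and_final (F : Cᵒᵖ ⥤ Type v) (X : C) :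
    Nonempty
      (CostructuredArrow.map (S := yoneda) (prod.fst : F ⨯ yoneda.obj X ⟶ F) ⊣
        timesRepresentableFunctor F X) ∧
    (timesRepresentableFunctor F X).Final := by
  exact ⟨⟨timesRepresentableFunctor.adjunction F X⟩,
    Functor.final_of_adjunction (timesRepresentableFunctor.adjunction F X)⟩
end
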